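/- arXiv:2411.03181 — 3 statements merged into one kernel-verified Lean document; each statement's English description precedes it below -/
import Mathlib

section
/- For every integer $n \geq 1$ and every real $x > 0$, the $n$-th derivative of the digamma function satisfies $\psi^{(n)}(x) = (-1)^{n+1}\, n!\, \sum_{k=0}^{\infty} \frac{1}{(k+x)^{n+1}}$. -/
/-- The digamma function `ψ(x) = Γ'(x)/Γ(x)`, i.e. the derivative of `t ↦ log (Γ t)`. -/
noncomputable def digamma (x : ℝ) : ℝ := deriv (fun t : ℝ => Real.log (Real.Gamma t)) x

theorem summable_one_div_nat_add_pow {a : ℝ} (ha : 0 < a) {p : ℕ} (hp : 2 ≤ p) :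
    Summable fun k : ℕ => 1 / ((k : ℝ) + a) ^ p := by
  have h := (Real.summable_one_div_nat_add_rpow a p).2 (by exact_mod_cast hp)
  refine h.congr fun k => ?_
  rw [abs_of_pos (by positivity), Real.rpow_natCast]

theorem hasDerivAt_one_div_nat_add_pow (k p : ℕ) {y : ℝ} (hy : 0 < y) :
    HasDerivAt (fun z : ℝ => 1 / ((k : ℝ) + z) ^ p) (-(p : ℝ) * (1 / ((k : ℝ) + y) ^ (p + 1))) y := by
  have hky : (k : ℝ) + y ≠ 0 := by positivity
  have h := ((((hasDerivAt_id' y).const_add (k : ℝ)).fun_pow p).fun_inv (pow_ne_zero p hky))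
  simp only [one_div]
  refine h.congr_deriv ?_
  rcases p with _ | q
  · simp
  · rw [Nat.add_sub_cancel]
    field_simp
    ring

theorem hasDerivAt_tsum_one_div_nat_add_pow {p : ℕ} (hp : 2 ≤ p) {x : ℝ} (hx : 0 < x) :
    HasDerivAt (fun y : ℝ => ∑' k : ℕ, 1 / ((k : ℝ) + y) ^ p)
      (-(p : ℝ) * ∑' k : ℕ, 1 / ((k : ℝ) + x) ^ (p + 1)) x := by
  have hx2 : 0 < x / 2 := half_pos hx
  have hxs : x ∈ Set.Ioi (x / 2) := half_lt_self hx
  rw [← tsum_mul_left]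
  refine hasDerivAt_tsum_of_isPreconnected
    (g' := fun (k : ℕ) (y : ℝ) => -(p : ℝ) * (1 / ((k : ℝ) + y) ^ (p + 1)))
    ((summable_one_div_nat_add_pow hx2 (by lia : 2 ≤ p + 1)).mul_left (p : ℝ))
    isOpen_Ioi isPreconnected_Ioi
    (fun k y hy => hasDerivAt_one_div_nat_add_pow k p (hx2.trans hy)) (fun k y hy => ?_) hxs
    (summable_one_div_nat_add_pow hx hp) hxs
  have hy' : x / 2 < y := hy
  have hy0 : 0 < y := hx2.trans hy'
  rw [norm_mul, norm_neg, Real.norm_natCast, Real.norm_of_nonneg (by positivity)]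
  gcongr

theorem hasDerivAt_one_div_sub_one_div_nat_add {k : ℕ} {y : ℝ} (hy : 0 < y) :
    HasDerivAt (fun z : ℝ => 1 / ((k : ℝ) + 1) - 1 / ((k : ℝ) + z)) (1 / ((k : ℝ) + y) ^ 2) y := by
  have hky : (k : ℝ) + y ≠ 0 := by positivity
  convert! (((hasDerivAt_id y).const_add (k : ℝ)).inv hky).const_sub (1 / ((k : ℝ) + 1)) using 1
  · ext z
    simp
  · simp [neg_div]

theorem hasDerivAt_tsum_one_div_sub_one_div_nat_add {x : ℝ} (hx : 0 < x) :
    HasDerivAt (fun y : ℝ => ∑' k : ℕ, (1 / ((k : ℝ) + 1) - 1 / ((k : ℝ) + y)))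
      (∑' k : ℕ, 1 / ((k : ℝ) + x) ^ 2) x := by
  set a := min x 1 / 2 with ha
  have ha0 : 0 < a := by positivity
  have hax : a < x := by linarith [min_le_left x 1]
  have ha1 : a < 1 := by linarith [min_le_right x 1]
  refine hasDerivAt_tsum_of_isPreconnected (y₀ := 1)
    (summable_one_div_nat_add_pow ha0 le_rfl)
    isOpen_Ioi isPreconnected_Ioi
    (fun k y hy => hasDerivAt_one_div_sub_one_div_nat_add (ha0.trans hy)) (fun k y hy => ?_)
    (Set.mem_Ioi.2 ha1) (by simp) (Set.mem_Ioi.2 hax)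
  have hy' : a < y := hy
  have hy0 := ha0.trans hy'
  rw [Real.norm_of_nonneg (by positivity)]
  gcongr

/-- The `k`-th term of the series for `log (Γ x) + γ (x - 1)`. -/
noncomputable def logGammaTerm (k : ℕ) (x : ℝ) : ℝ :=
  (x - 1) / ((k : ℝ) + 1) - Real.log (k + x) + Real.log (k + 1)

theorem hasDerivAt_logGammaTerm (k : ℕ) {y : ℝ} (hy : 0 < y) :
    HasDerivAt (logGammaTerm k) (1 / ((k : ℝ) + 1) - 1 / ((k : ℝ) + y)) y := by
  have hky : (k : ℝ) + y ≠ 0 := by positivity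
  exact ((((hasDerivAt_id y).sub_const 1).div_const _).sub
    (((hasDerivAt_id y).const_add (k : ℝ)).log hky)).add_const _

theorem norm_one_div_sub_one_div_nat_add_le {a b y : ℝ} (ha : 0 < a) (ha1 : a ≤ 1) (hb : 1 ≤ b)
    (hy : y ∈ Set.Ioo a b) (k : ℕ) :
    ‖1 / ((k : ℝ) + 1) - 1 / ((k : ℝ) + y)‖ ≤ b * (1 / ((k : ℝ) + a) ^ 2) := by
  obtain ⟨hay, hyb⟩ := hy
  have hy0 : 0 < y := ha.trans hay
  have hky : 0 < (k : ℝ) + y := by positivity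
  have h : 1 / ((k : ℝ) + 1) - 1 / ((k : ℝ) + y) = (y - 1) / (((k : ℝ) + 1) * (k + y)) := by
    field_simp
    ring
  rw [h, norm_div, Real.norm_of_nonneg (by positivity : 0 ≤ ((k : ℝ) + 1) * (k + y)),
    mul_one_div, Real.norm_eq_abs, sq]
  gcongr
  exact abs_le.2 ⟨by linarith, by linarith⟩

theorem summable_logGammaTerm_and_hasDerivAt_tsum {x : ℝ} (hx : 0 < x) :
    (Summable fun k => logGammaTerm k x) ∧
      HasDerivAt (fun y => ∑' k, logGammaTerm k y)
        (∑' k : ℕ, (1 / ((k : ℝ) + 1) - 1 / ((k : ℝ) + x))) x := by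
  set a := min x 1 / 2 with ha
  have ha0 : 0 < a := by positivity
  have hax : a < x := by linarith [min_le_left x 1]
  have ha1 : a < 1 := by linarith [min_le_right x 1]
  have hu := (summable_one_div_nat_add_pow ha0 le_rfl).mul_left (x + 1)
  have hg : ∀ (k : ℕ), ∀ y ∈ Set.Ioo a (x + 1), HasDerivAt (logGammaTerm k) _ y :=
    fun k y hy => hasDerivAt_logGammaTerm k (ha0.trans hy.1)
  have hg' : ∀ (k : ℕ), ∀ y ∈ Set.Ioo a (x + 1), _ :=
    fun k y hy => norm_one_div_sub_one_div_nat_add_le ha0 ha1.le (by linarith) hy k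
  have h1 : (1 : ℝ) ∈ Set.Ioo a (x + 1) := ⟨ha1, by linarith⟩
  have hxs : x ∈ Set.Ioo a (x + 1) := ⟨hax, by linarith⟩
  have h0 : Summable fun k => logGammaTerm k 1 := by simp [logGammaTerm]
  exact ⟨summable_of_summable_hasDerivAt_of_isPreconnected hu isOpen_Ioo isPreconnected_Ioo
      hg hg' h1 h0 hxs,
    hasDerivAt_tsum_of_isPreconnected hu isOpen_Ioo isPreconnected_Ioo hg hg' h1 h0 hxs⟩

theorem sum_range_logGammaTerm (x : ℝ) (n : ℕ) :
    ∑ k ∈ Finset.range n, logGammaTerm k x =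
      (x - 1) * harmonic n - ∑ k ∈ Finset.range n, Real.log (x + k) + Real.log n.factorial := by
  induction n with
  | zero => simp
  | succ n ih =>
    rw [Finset.sum_range_succ, ih, Finset.sum_range_succ, harmonic_succ, Nat.factorial_succ,
      Nat.cast_mul, Real.log_mul (by positivity) (by positivity), logGammaTerm, add_comm x (n : ℝ)]
    push_cast
    ring

theorem tsum_logGammaTerm {x : ℝ} (hx : 0 < x) :
    ∑' k, logGammaTerm k x =
      Real.log (Real.Gamma x) + Real.eulerMascheroniConstant * (x - 1) := by
  have hS := (summable_logGammaTerm_and_hasDerivAt_tsum hx).1.hasSum.tendsto_sum_nat.comp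
    (Filter.tendsto_add_atTop_nat 1)
  refine tendsto_nhds_unique hS ?_
  have hlog := Real.tendsto_log_nat_add_one_sub_log
  have hγ := (Real.tendsto_harmonic_sub_log.comp (Filter.tendsto_add_atTop_nat 1)).mul_const (x - 1)
  have hΓ := Real.BohrMollerup.tendsto_log_gamma hx
  have h := (hΓ.add hγ).add (hlog.const_mul x)
  rw [mul_zero, add_zero] at h
  refine h.congr fun n => ?_
  simp only [Function.comp_apply, sum_range_logGammaTerm, Real.BohrMollerup.logGammaSeq,
    Nat.factorial_succ]
  rw [Nat.cast_mul, Real.log_mul (by positivity) (by positivity)]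
  push_cast
  ring

theorem digamma_eq_tsum {x : ℝ} (hx : 0 < x) :
    digamma x = ∑' k : ℕ, (1 / ((k : ℝ) + 1) - 1 / ((k : ℝ) + x)) -
      Real.eulerMascheroniConstant := by
  have h := (summable_logGammaTerm_and_hasDerivAt_tsum hx).2.sub
    (((hasDerivAt_id x).sub_const 1).const_mul Real.eulerMascheroniConstant)
  rw [mul_one] at h
  refine (h.congr_of_eventuallyEq ?_).deriv
  filter_upwards [Ioi_mem_nhds hx] with y hy
  simp [tsum_logGammaTerm hy]

/-- For `n ≥ 1` and `x > 0`, `ψ⁽ⁿ⁾(x) = (-1)^{n+1} n! ∑_{k=0}^∞ (k+x)^{-(n+1)}`. -/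
theorem iteratedDeriv_digamma (n : ℕ) (hn : 1 ≤ n) (x : ℝ) (hx : 0 < x) :
    iteratedDeriv n digamma x =
      (-1) ^ (n + 1) * (n.factorial : ℝ) * ∑' k : ℕ, 1 / ((k : ℝ) + x) ^ (n + 1) := by
  induction n, hn using Nat.le_induction generalizing x with
  | base =>
    rw [iteratedDeriv_one]
    have h := (hasDerivAt_tsum_one_div_sub_one_div_nat_add hx).sub_const
      Real.eulerMascheroniConstant
    rw [(h.congr_of_eventuallyEq ?_).deriv]
    · simp
    · filter_upwards [Ioi_mem_nhds hx] with y hy using digamma_eq_tsum hy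
  | succ n hn ih =>
    rw [iteratedDeriv_succ]
    have h := (hasDerivAt_tsum_one_div_nat_add_pow (p := n + 1) (by lia) hx).const_mul
      ((-1) ^ (n + 1) * (n.factorial : ℝ))
    rw [(h.congr_of_eventuallyEq ?_).deriv]
    · rw [Nat.factorial_succ]
      push_cast
      ring
    · filter_upwards [Ioi_mem_nhds hx] with y hy using ih y hy
end

section
/- For every integer $n \geq 1$, the $n$-th derivative of the digamma function at $1$ satisfies $\psi^{(n)}(1) = (-1)^{n+1}\, n!\, \zeta(n+1)$, where $\zeta$ is the Riemann zeta function. -/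
open Filter Set
open scoped Topology

lemma differentiableAt_log_Gamma {x : ℝ} (hx : 0 < x) :
    DifferentiableAt ℝ (fun t : ℝ => Real.log (Real.Gamma t)) x :=
  (Real.differentiableAt_Gamma fun m => by
    have : (0 : ℝ) ≤ m := m.cast_nonneg
    linarith).log (Real.Gamma_pos_of_pos hx).ne'

lemma log_Gamma_add_one {x : ℝ} (hx : 0 < x) :
    Real.log (Real.Gamma (x + 1)) = Real.log x + Real.log (Real.Gamma x) := by
  rw [Real.Gamma_add_one hx.ne', Real.log_mul hx.ne' (Real.Gamma_pos_of_pos hx).ne']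

lemma digamma_add_one {x : ℝ} (hx : 0 < x) : digamma (x + 1) = digamma x + 1 / x := by
  have h : (fun t : ℝ => Real.log (Real.Gamma (t + 1))) =ᶠ[𝓝 x]
      fun t => Real.log t + Real.log (Real.Gamma t) := by
    filter_upwards [Ioi_mem_nhds hx] with t ht using log_Gamma_add_one ht
  have h' := h.deriv_eq
  rw [deriv_comp_add_const (fun t : ℝ => Real.log (Real.Gamma t)),
    deriv_fun_add (Real.differentiableAt_log hx.ne') (differentiableAt_log_Gamma hx),
    Real.deriv_log] at h'
  rw [digamma, digamma, h', one_div, add_comm]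

lemma digamma_add_nat {x : ℝ} (hx : 0 < x) (N : ℕ) :
    digamma (x + N) = digamma x + ∑ k ∈ Finset.range N, 1 / (x + k) := by
  induction N with
  | zero => simp
  | succ N ih =>
    rw [Finset.sum_range_succ, Nat.cast_succ, ← add_assoc, digamma_add_one (by positivity), ih,
      add_assoc]

lemma digamma_le_log {x : ℝ} (hx : 0 < x) : digamma x ≤ Real.log x := by
  have h := Real.convexOn_log_Gamma.deriv_le_slope (mem_Ioi.2 hx)
    (mem_Ioi.2 (by linarith : 0 < x + 1)) (by linarith) (differentiableAt_log_Gamma hx)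
  simpa [digamma, Function.comp_def, slope_def_field, log_Gamma_add_one hx] using h

lemma log_le_digamma_add_one {x : ℝ} (hx : 0 < x) : Real.log x ≤ digamma (x + 1) := by
  have hx1 : 0 < x + 1 := by linarith
  have h := Real.convexOn_log_Gamma.slope_le_deriv (mem_Ioi.2 hx)
    (mem_Ioi.2 hx1) (by linarith) (differentiableAt_log_Gamma hx1)
  simpa [digamma, Function.comp_def, slope_def_field, log_Gamma_add_one hx] using h

lemma tendsto_digamma_sub_log : Tendsto (fun x => digamma x - Real.log x) atTop (𝓝 0) := by
  refine tendsto_of_tendsto_of_tendsto_of_le_of_le'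
    (Real.tendsto_log_comp_add_sub_log (-1)) tendsto_const_nhds ?_ ?_
  · filter_upwards [eventually_gt_atTop 1] with x hx
    have := log_le_digamma_add_one (x := x + -1) (by linarith)
    rw [neg_add_cancel_right] at this
    linarith
  · filter_upwards [eventually_gt_atTop 0] with x hx
    linarith [digamma_le_log hx]

lemma tendsto_digamma_add_nat_sub_log (x : ℝ) :
    Tendsto (fun N : ℕ => digamma (x + N) - Real.log N) atTop (𝓝 0) := by
  have h₁ := tendsto_digamma_sub_log.comp
    (tendsto_atTop_add_const_left atTop x (tendsto_natCast_atTop_atTop (R := ℝ)))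
  have h₂ := (Real.tendsto_log_comp_add_sub_log x).comp (tendsto_natCast_atTop_atTop (R := ℝ))
  have h := h₁.add h₂
  rw [add_zero] at h
  refine h.congr fun N => ?_
  simp only [Function.comp_apply, add_comm x]
  ring

lemma tendsto_sum_digamma {x : ℝ} (hx : 0 < x) :
    Tendsto (fun N : ℕ => ∑ k ∈ Finset.range N, (1 / (1 + k : ℝ) - 1 / (x + k)))
      atTop (𝓝 (digamma x - digamma 1)) := by
  have h := (((tendsto_digamma_add_nat_sub_log 1).sub
    (tendsto_digamma_add_nat_sub_log x)).add_const (digamma x - digamma 1))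
  rw [sub_zero, zero_add] at h
  refine h.congr fun N => ?_
  rw [digamma_add_nat hx, digamma_add_nat one_pos, Finset.sum_sub_distrib]
  ring

lemma summable_one_div_add_nat_pow {x : ℝ} (hx : 0 < x) {m : ℕ} (hm : 1 < m) :
    Summable fun k : ℕ => 1 / (x + k) ^ m := by
  refine ((Real.summable_one_div_nat_add_rpow x m).2 (by exact_mod_cast hm)).congr fun k => ?_
  rw [Real.rpow_natCast, abs_of_pos (by positivity), add_comm]

lemma hasDerivAt_one_div_add_pow (c : ℝ) (m : ℕ) {x : ℝ} (hx : x + c ≠ 0) :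
    HasDerivAt (fun y => 1 / (y + c) ^ m) (-m * (1 / (x + c) ^ (m + 1))) x := by
  simp only [one_div]
  refine ((((hasDerivAt_id' x).add_const c).fun_pow m).fun_inv (pow_ne_zero m hx)).congr_deriv ?_
  rcases m with _ | m
  · simp
  · rw [Nat.add_sub_cancel]
    field_simp
    ring

lemma one_div_add_pow_le {a x : ℝ} (ha : 0 < a) (hx : a ≤ x) (k m : ℕ) :
    1 / (x + k) ^ m ≤ 1 / (a + k) ^ m := by
  gcongr

lemma hasDerivAt_tsum_one_div_add_pow {x : ℝ} (hx : 0 < x) {m : ℕ} (hm : 1 < m) :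
    HasDerivAt (fun y : ℝ => ∑' k : ℕ, 1 / (y + k) ^ m)
      (-m * ∑' k : ℕ, 1 / (x + k) ^ (m + 1)) x := by
  have ha : 0 < x / 2 := by positivity
  have hxa : x ∈ Ioi (x / 2) := by rw [mem_Ioi]; linarith
  have hu := (summable_one_div_add_nat_pow ha (m := m + 1) (by lia)).mul_left (m : ℝ)
  have hd (k : ℕ) (y : ℝ) (hy : y ∈ Ioi (x / 2)) :
      HasDerivAt (fun y : ℝ => 1 / (y + k) ^ m) (-m * (1 / (y + k) ^ (m + 1))) y := by
    have hy : 0 < y := ha.trans hy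
    exact hasDerivAt_one_div_add_pow _ _ (by positivity)
  have hb (k : ℕ) (y : ℝ) (hy : y ∈ Ioi (x / 2)) :
      ‖-m * (1 / (y + k) ^ (m + 1))‖ ≤ m * (1 / (x / 2 + k) ^ (m + 1)) := by
    have hy0 : 0 < y := ha.trans hy
    rw [norm_mul, norm_neg, Real.norm_natCast, Real.norm_of_nonneg (by positivity)]
    exact mul_le_mul_of_nonneg_left (one_div_add_pow_le ha hy.le k _) m.cast_nonneg
  have h := hasDerivAt_tsum_of_isPreconnected hu isOpen_Ioi isPreconnected_Ioi hd hb hxa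
    (summable_one_div_add_nat_pow hx hm) hxa
  rwa [tsum_mul_left] at h

lemma hasDerivAt_digamma {x : ℝ} (hx : 0 < x) :
    HasDerivAt digamma (∑' k : ℕ, 1 / (x + k) ^ 2) x := by
  set a := min 1 x / 2 with ha_def
  have ha : 0 < a := by positivity
  have hxa : x ∈ Ioi a := by rw [mem_Ioi]; linarith [min_le_right 1 x]
  have h1a : (1 : ℝ) ∈ Ioi a := by rw [mem_Ioi]; linarith [min_le_left 1 x]
  have hu := summable_one_div_add_nat_pow ha one_lt_two
  have hd (k : ℕ) (y : ℝ) (hy : y ∈ Ioi a) :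
      HasDerivAt (fun y : ℝ => 1 / (1 + k : ℝ) - 1 / (y + k)) (1 / (y + k) ^ 2) y := by
    have hy : 0 < y := ha.trans hy
    simpa using (hasDerivAt_one_div_add_pow (k : ℝ) 1 (x := y) (by positivity)).const_sub
      (1 / (1 + k : ℝ))
  have hb (k : ℕ) (y : ℝ) (hy : y ∈ Ioi a) : ‖1 / (y + k) ^ 2‖ ≤ 1 / (a + k) ^ 2 := by
    have hy0 : 0 < y := ha.trans hy
    rw [Real.norm_of_nonneg (by positivity)]
    exact one_div_add_pow_le ha hy.le k 2
  have h0 : Summable fun k : ℕ => 1 / (1 + k : ℝ) - 1 / (1 + k) := by simp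
  have hsum := hasDerivAt_tsum_of_isPreconnected hu isOpen_Ioi isPreconnected_Ioi hd hb h1a h0 hxa
  refine (hsum.const_add (digamma 1)).congr_of_eventuallyEq ?_
  filter_upwards [isOpen_Ioi.mem_nhds hxa] with y hy
  have hs := summable_of_summable_hasDerivAt_of_isPreconnected hu isOpen_Ioi isPreconnected_Ioi
    hd hb h1a h0 hy
  have := tendsto_nhds_unique hs.hasSum.tendsto_sum_nat (tendsto_sum_digamma (ha.trans hy))
  rw [this]
  ring

lemma iteratedDeriv_succ_digamma (n : ℕ) {x : ℝ} (hx : 0 < x) :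
    iteratedDeriv (n + 1) digamma x =
      (-1) ^ n * (n + 1).factorial * ∑' k : ℕ, 1 / (x + k) ^ (n + 2) := by
  induction n generalizing x with
  | zero => simpa using (hasDerivAt_digamma hx).deriv
  | succ n ih =>
    have h : iteratedDeriv (n + 1) digamma =ᶠ[𝓝 x] fun y =>
        (-1) ^ n * (n + 1).factorial * ∑' k : ℕ, 1 / (y + k) ^ (n + 2) := by
      filter_upwards [Ioi_mem_nhds hx] with y hy using ih hy
    rw [iteratedDeriv_succ, h.deriv_eq,
      ((hasDerivAt_tsum_one_div_add_pow hx (by lia)).const_mul _).deriv,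
      Nat.factorial_succ (n + 1)]
    push_cast
    ring

/-- For `n ≥ 1`, `ψ⁽ⁿ⁾(1) = (-1)^{n+1} n! ζ(n+1)`. -/
theorem iteratedDeriv_digamma_one (n : ℕ) (hn : 1 ≤ n) :
    (↑(iteratedDeriv n digamma 1) : ℂ) =
      (-1) ^ (n + 1) * (n.factorial : ℂ) * riemannZeta (n + 1) := by
  obtain ⟨n, rfl⟩ := Nat.exists_eq_add_of_le' hn
  have hre : 1 < ((n + 1 : ℕ) + 1 : ℂ).re := by
    simp only [Complex.add_re, Complex.natCast_re, Complex.one_re]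
    push_cast
    linarith [n.cast_nonneg (α := ℝ)]
  rw [iteratedDeriv_succ_digamma n one_pos, zeta_eq_tsum_one_div_nat_add_one_cpow hre]
  push_cast
  congr 1
  · ring
  · refine tsum_congr fun k => ?_
    rw [add_comm (1 : ℂ) k, ← Complex.cpow_natCast]
    push_cast
    ring_nf
end

section
/- Let $x_m$ be the unique point in $(0,\infty)$ at which the real Gamma function attains its minimum on $(0,\infty)$, and set $\eta = \gamma + \log 4 - 2$. Then the first-order Lagrange inversion approximation at $a = 3/2$ satisfies $\left| x_m - \left( \tfrac{3}{2} + \tfrac{2\eta}{\pi^{2} - 8} \right) \right| < 10^{-3}$. -/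
open Filter Set
open scoped Topology

theorem differentiableAt_Gamma_of_pos {x : ℝ} (hx : 0 < x) :
    DifferentiableAt ℝ Real.Gamma x :=
  Real.differentiableAt_Gamma fun m => ((neg_nonpos.mpr m.cast_nonneg).trans_lt hx).ne'

theorem monotoneOn_logDeriv_Gamma : MonotoneOn (logDeriv Real.Gamma) (Ioi 0) := by
  have hmono := Real.convexOn_log_Gamma.monotoneOn_deriv fun x (hx : 0 < x) =>
    (differentiableAt_Gamma_of_pos hx).log (Real.Gamma_pos_of_pos hx).ne'
  refine hmono.congr fun x (hx : 0 < x) => ?_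
  exact ((differentiableAt_Gamma_of_pos hx).hasDerivAt.log (Real.Gamma_pos_of_pos hx).ne').deriv

theorem logDeriv_Gamma_add_one {x : ℝ} (hx : 0 < x) :
    logDeriv Real.Gamma (x + 1) = logDeriv Real.Gamma x + 1 / x := by
  have hderiv : deriv Real.Gamma (x + 1) = Real.Gamma x + x * deriv Real.Gamma x := by
    rw [← deriv_comp_add_const]
    have hprod := (hasDerivAt_id x).mul (differentiableAt_Gamma_of_pos hx).hasDerivAt
    refine (hprod.congr_of_eventuallyEq ?_).deriv.trans (by simp)
    filter_upwards [eventually_gt_nhds hx] with y hy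
    exact Real.Gamma_add_one hy.ne'
  have hG := (Real.Gamma_pos_of_pos hx).ne'
  rw [logDeriv_apply, logDeriv_apply, hderiv, Real.Gamma_add_one hx.ne']
  field_simp
  ring

theorem logDeriv_Gamma_add_nat {x : ℝ} (hx : 0 < x) (n : ℕ) :
    logDeriv Real.Gamma (x + n) =
      logDeriv Real.Gamma x + ∑ i ∈ Finset.range n, 1 / (x + i) := by
  induction n with
  | zero => simp
  | succ n ih =>
    rw [Finset.sum_range_succ, ← add_assoc, ← ih, ← logDeriv_Gamma_add_one (by positivity)]
    push_cast
    rw [add_assoc]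

theorem logDeriv_Gamma_one : logDeriv Real.Gamma 1 = -Real.eulerMascheroniConstant := by
  rw [logDeriv_apply, Real.hasDerivAt_Gamma_one.deriv, Real.Gamma_one, div_one]

theorem logDeriv_Gamma_three_halves :
    logDeriv Real.Gamma (3 / 2) = 2 - Real.eulerMascheroniConstant - Real.log 4 := by
  have hlog : Real.log 4 = 2 * Real.log 2 := by
    rw [show (4 : ℝ) = 2 ^ 2 by norm_num, Real.log_pow]; norm_num
  have hpi : √Real.pi ≠ 0 := (Real.sqrt_pos.mpr Real.pi_pos).ne'
  rw [show (3 / 2 : ℝ) = 1 / 2 + 1 by norm_num, logDeriv_Gamma_add_one (by norm_num),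
    logDeriv_apply, Real.hasDerivAt_Gamma_one_half.deriv, Real.Gamma_one_half_eq, hlog]
  field_simp
  ring

theorem hasSum_logDeriv_Gamma_sub {x a : ℝ} (hx : 0 < x) (hxa : x ≤ a) (hax : a ≤ x + 1) :
    HasSum (fun n : ℕ => 1 / (x + n) - 1 / (a + n))
      (logDeriv Real.Gamma a - logDeriv Real.Gamma x) := by
  have ha : 0 < a := hx.trans_le hxa
  rw [hasSum_iff_tendsto_nat_of_nonneg fun n => sub_nonneg.mpr (by gcongr)]
  have hinv : Tendsto (fun n : ℕ => 1 / (x + n)) atTop (𝓝 0) := by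
    simp only [one_div]
    exact tendsto_inv_atTop_zero.comp
      (tendsto_atTop_add_const_left _ x tendsto_natCast_atTop_atTop)
  have hrem : Tendsto (fun n : ℕ => logDeriv Real.Gamma (a + n) - logDeriv Real.Gamma (x + n))
      atTop (𝓝 0) := by
    refine squeeze_zero (fun n => sub_nonneg.mpr ?_) (fun n => ?_) hinv
    · exact monotoneOn_logDeriv_Gamma (mem_Ioi.mpr (by positivity)) (mem_Ioi.mpr (by positivity))
        (by linarith)
    · rw [sub_le_iff_le_add', ← logDeriv_Gamma_add_one (by positivity)]
      exact monotoneOn_logDeriv_Gamma (mem_Ioi.mpr (by positivity)) (mem_Ioi.mpr (by positivity))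
        (by linarith)
  have hlim := hrem.const_sub (logDeriv Real.Gamma a - logDeriv Real.Gamma x)
  rw [sub_zero] at hlim
  refine hlim.congr fun n => ?_
  rw [logDeriv_Gamma_add_nat hx, logDeriv_Gamma_add_nat ha, Finset.sum_sub_distrib]
  ring

theorem hasSum_one_div_three_halves_add_sq :
    HasSum (fun n : ℕ => 1 / ((3 / 2 : ℝ) + n) ^ 2) ((Real.pi ^ 2 - 8) / 2) := by
  have hz := hasSum_zeta_two
  have heven : HasSum (fun n : ℕ => 1 / ((2 * n : ℕ) : ℝ) ^ 2) (1 / 4 * (Real.pi ^ 2 / 6)) := by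
    convert! hz.mul_left (1 / 4) using 1
    ext n
    push_cast
    rw [mul_pow, one_div_mul_one_div]
    norm_num
  have hodd : Summable (fun n : ℕ => 1 / ((2 * n + 1 : ℕ) : ℝ) ^ 2) :=
    hz.summable.comp_injective (i := fun n : ℕ => 2 * n + 1) fun m n h => by
      simpa using h
  obtain ⟨s, hs⟩ := hodd
  have hsum := (HasSum.even_add_odd (f := fun n : ℕ => 1 / (n : ℝ) ^ 2) heven hs).unique hz
  have hs' : s = Real.pi ^ 2 / 8 := by linarith
  subst hs'
  have hshift := ((hasSum_nat_add_iff' 1).mpr hs).mul_left 4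
  have hval : 4 * (Real.pi ^ 2 / 8 - ∑ i ∈ Finset.range 1, 1 / ((2 * i + 1 : ℕ) : ℝ) ^ 2) =
      (Real.pi ^ 2 - 8) / 2 := by
    rw [Finset.sum_range_one]
    push_cast
    ring
  rw [hval] at hshift
  convert! hshift using 1
  ext n
  push_cast
  have h2 : (2 * ((n : ℝ) + 1) + 1) = 2 * (3 / 2 + n) := by ring
  rw [h2, mul_pow, ← one_div_mul_one_div]
  ring

set_option maxRecDepth 10000 in
theorem lt_eulerMascheroniConstant : (0.575 : ℝ) < Real.eulerMascheroniConstant := by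
  refine lt_of_le_of_lt ?_ (Real.eulerMascheroniSeq_lt_eulerMascheroniConstant 255)
  have hharm : (6.1203 : ℚ) ≤ harmonic 255 := by
    norm_num [harmonic, Finset.sum_range_succ]
  have hharm' : (6.1203 : ℝ) ≤ harmonic 255 :=
    le_trans (by norm_num) ((Rat.cast_le (K := ℝ)).mpr hharm)
  have hlog : Real.log ((255 : ℕ) + 1) = 8 * Real.log 2 := by
    rw [show (((255 : ℕ) : ℝ) + 1) = 2 ^ 8 by norm_num, Real.log_pow]; norm_num
  rw [Real.eulerMascheroniSeq, hlog]
  linarith [Real.log_two_lt_d9]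

theorem eulerMascheroniConstant_lt : Real.eulerMascheroniConstant < (0.61 : ℝ) := by
  refine (Real.eulerMascheroniConstant_lt_eulerMascheroniSeq' 16).trans_le ?_
  have hlog : Real.log (16 : ℕ) = 4 * Real.log 2 := by
    rw [show ((16 : ℕ) : ℝ) = 2 ^ 4 by norm_num, Real.log_pow]; norm_num
  rw [Real.eulerMascheroniSeq', if_neg (by norm_num), hlog]
  norm_num [harmonic, Finset.sum_range_succ]
  linarith [Real.log_two_gt_d9]

/-- First-order Lagrange inversion approximation at `a = 3/2` for the minimizer of `Γ`:
with `η = γ + log 4 - 2`, `|x_m - (3/2 + 2η/(π² - 8))| < 10⁻³`. -/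
theorem Gamma_min_first_order_approx (x : ℝ) (hx : 0 < x)
    (hmin : ∀ y : ℝ, 0 < y → Real.Gamma x ≤ Real.Gamma y)
    (η : ℝ) (hη : η = Real.eulerMascheroniConstant + Real.log 4 - 2) :
    |x - (3 / 2 + 2 * η / (Real.pi ^ 2 - 8))| < 1 / 1000 := by
  have hlog : Real.log 4 = 2 * Real.log 2 := by
    rw [show (4 : ℝ) = 2 ^ 2 by norm_num, Real.log_pow]; norm_num
  have hcrit : logDeriv Real.Gamma x = 0 := by
    have hloc : IsLocalMin Real.Gamma x := by
      filter_upwards [eventually_gt_nhds hx] with y hy using hmin y hy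
    rw [logDeriv_apply, hloc.deriv_eq_zero, zero_div]
  have hval : logDeriv Real.Gamma (3 / 2) = -η := by
    rw [logDeriv_Gamma_three_halves, hη]; ring
  have hη0 : 0 < -η := by
    linarith [eulerMascheroniConstant_lt, Real.log_two_lt_d9]
  have hη1 : -η < 0.0388 := by
    linarith [lt_eulerMascheroniConstant, Real.log_two_gt_d9]
  have hx1 : 1 < x := by
    by_contra! h
    have := monotoneOn_logDeriv_Gamma (mem_Ioi.mpr hx) (mem_Ioi.mpr one_pos) h
    rw [hcrit, logDeriv_Gamma_one] at this
    linarith [lt_eulerMascheroniConstant]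
  have hx2 : x < 3 / 2 := by
    by_contra! h
    have := monotoneOn_logDeriv_Gamma (mem_Ioi.mpr (by norm_num)) (mem_Ioi.mpr hx) h
    rw [hcrit, hval] at this
    linarith
  have hf := hasSum_logDeriv_Gamma_sub hx hx2.le (by linarith)
  rw [hcrit, hval, sub_zero] at hf
  have hg := hasSum_one_div_three_halves_add_sq
  set S : ℝ := (Real.pi ^ 2 - 8) / 2 with hS
  have hSlo : 0.934 < S := by
    rw [hS]; nlinarith [Real.pi_gt_d4]
  have hShi : S < 0.936 := by
    rw [hS]; nlinarith [Real.pi_lt_d4, Real.pi_pos]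
  obtain ⟨d, hd⟩ : ∃ d, d = 3 / 2 - x := ⟨_, rfl⟩
  have hd0 : 0 < d := by linarith
  have hterm (n : ℕ) : 1 / (x + n) - 1 / (3 / 2 + n) =
      d * (1 / ((3 / 2 : ℝ) + n) ^ 2) + d ^ 2 / (x + n) * (1 / ((3 / 2 : ℝ) + n) ^ 2) := by
    have : x + n ≠ 0 := by positivity
    rw [hd]
    field_simp
    ring
  have hlower : d * S ≤ -η := by
    refine hasSum_le (fun n => ?_) (hg.mul_left d) hf
    rw [hterm]
    exact le_add_of_nonneg_right (by positivity)
  have hd1 : d < 0.0416 := by nlinarith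
  have hupper : -η ≤ (d + d ^ 2 / (x + 1)) * S + d ^ 2 * (4 / 9) * (1 / x - 1 / (x + 1)) := by
    refine hasSum_le (fun n => ?_) hf ((hg.mul_left (d + d ^ 2 / (x + 1))).add
      (hasSum_ite_eq 0 (d ^ 2 * (4 / 9) * (1 / x - 1 / (x + 1)))))
    rw [hterm, add_mul]
    rcases Nat.eq_zero_or_pos n with rfl | hn
    · simp only [if_true, Nat.cast_zero, add_zero]
      apply le_of_eq
      field_simp
      ring
    · rw [if_neg hn.ne', add_zero]
      have : (1 : ℝ) ≤ n := by exact_mod_cast hn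
      gcongr
  have hxlo : 1.458 < x := by norm_num at hd1 ⊢; linarith
  have hb1 : 1 / x < 0.686 := by
    rw [div_lt_iff₀ hx]; linarith
  have hb2 : 1 / (x + 1) < 0.407 := by
    rw [div_lt_iff₀ (by linarith)]; linarith
  have hdsq : d ^ 2 < 0.001731 := by nlinarith
  have hgap : -η - d * S < S / 1000 := by
    have hcoef : 1 / (x + 1) * S + 4 / 9 * (1 / x - 1 / (x + 1)) < 0.51 := by
      nlinarith
    have hrw : -η - d * S ≤ d ^ 2 * (1 / (x + 1) * S + 4 / 9 * (1 / x - 1 / (x + 1))) := by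
      have : d ^ 2 / (x + 1) = d ^ 2 * (1 / (x + 1)) := by ring
      rw [this] at hupper
      linarith
    nlinarith [sq_pos_of_pos hd0]
  have hS0 : 0 < S := by linarith
  have herr : x - (3 / 2 + 2 * η / (Real.pi ^ 2 - 8)) = (-η - d * S) / S := by
    have : Real.pi ^ 2 - 8 = 2 * S := by rw [hS]; ring
    rw [this, hd]
    field_simp
    ring
  rw [herr, abs_of_nonneg (div_nonneg (by linarith) hS0.le), div_lt_iff₀ hS0]
  linarith
end
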